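/- Let A be an elliptic curve over a finite field k with q elements, and define the integer a by |A(k)| = 1 - a + q. Then |a| ≤ 2√q, i.e., a² ≤ 4q. -/

import Mathlib

open Polynomial

/-- A nonnegative integer-valued function satisfying the parallelogram law obeys the
Cauchy–Schwarz inequality, here in the normalisation used for Hasse's theorem. -/
theorem sq_le_four_mul_of_parallelogram {V : Type*} [AddCommGroup V] (h : V → ℤ)
    (hnonneg : ∀ v, 0 ≤ h v)
    (hpar : ∀ u v, h (u + v) + h (u - v) = 2 * h u + 2 * h v)
    {g p : V} {a q : ℤ} (hg : h g = 1) (hp : h p = q) (hpg : h (p - g) = q + 1 - a) :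
    a ^ 2 ≤ 4 * q := by
  have h0 : h 0 = 0 := by
    have := hpar 0 0
    simp at this
    omega
  have h2 : h (p + p) = 4 * q := by
    have := hpar p p
    rw [sub_self, h0] at this
    omega
  have h1 : h (p + p - g) = 4 * q - 2 * a + 1 := by
    have := hpar p (p - g)
    rw [sub_sub_cancel, ← add_sub_assoc] at this
    omega
  have key : ∀ n : ℤ, h (p + p + n • g) = 4 * q + 2 * a * n + n ^ 2 ∧
      h (p + p + (n - 1) • g) = 4 * q + 2 * a * (n - 1) + (n - 1) ^ 2 := by
    have rec' : ∀ n : ℤ, h (p + p + (n + 1) • g) + h (p + p + (n - 1) • g) =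
        2 * h (p + p + n • g) + 2 := by
      intro n
      have := hpar (p + p + n • g) g
      rw [hg] at this
      rw [add_smul, sub_smul, one_smul, ← add_assoc, ← add_sub_assoc]
      linarith
    intro n
    induction n using Int.induction_on with
    | zero =>
      refine ⟨by simpa using h2, ?_⟩
      have : p + p + ((0 : ℤ) - 1) • g = p + p - g := by simp [sub_eq_add_neg]
      rw [this, h1]
      ring
    | succ n ih =>
      have := rec' n
      rw [ih.1, ih.2] at this
      rw [add_sub_cancel_right]
      exact ⟨by linarith, ih.1⟩
    | pred n ih =>
      have := rec' (-n - 1)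
      rw [sub_add_cancel, ih.1, ih.2] at this
      exact ⟨ih.2, by linarith⟩
  have := (key (-a)).1
  nlinarith [hnonneg (p + p + (-a) • g)]

namespace WeierstrassCurve.Affine.Point

variable {F : Type*} [Field F] [DecidableEq F] (W : WeierstrassCurve F) [W.IsElliptic]

/-- The map `addSubMap` sends the class of `{P, Q}` to the class of `{P + Q, P - Q}`. -/
theorem exists_addSubMap_sym2x (P Q : W.toAffine.Point) : ∃ u : F, u ≠ 0 ∧ ∀ i,
    (W.addSubMap i).eval (P.sym2x Q) = u * (P + Q).sym2x (P - Q) i := by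
  have hself (P : W.toAffine.Point) : ∃ u : F, u ≠ 0 ∧ ∀ i,
      (W.addSubMap i).eval (P.sym2x P) = u * (P + P).sym2x 0 i := by
    have hne := W.addSubMap_ne_zero (P.sym2x_ne_zero P)
    rcases P with _ | ⟨x, y, h⟩
    · refine ⟨1, one_ne_zero, fun i ↦ ?_⟩
      rw [← zero_def]
      fin_cases i <;> simp [addSubMap]
    by_cases hy : y = W.toAffine.negY x y
    · rw [add_self_of_Y_eq hy]
      have h1 : 4 * x ^ 3 + W.b₂ * x ^ 2 + 2 * W.b₄ * x + W.b₆ = 0 := by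
        have := (equation_iff' ..).mp h.1
        simp only [negY] at hy
        simp only [b₂, b₄, b₆]
        linear_combination (2 * y + W.a₁ * x + W.a₃) * hy - 4 * this
      refine ⟨x ^ 4 - W.b₄ * x ^ 2 - 2 * W.b₆ * x - W.b₈, fun h0 ↦ hne ?_, fun i ↦ ?_⟩
      · ext i
        fin_cases i
        · simp [addSubMap]
          linear_combination h0
        · simp [addSubMap]
          linear_combination h1
        · simp [addSubMap]
          ring
      · fin_cases i
        · simp [addSubMap]
          ring
        · simp [addSubMap]
          linear_combination h1
        · simp [addSubMap]
          ring
    · rw [add_self_of_Y_ne hy, sym2x_some_some, sym2x_some_zero]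
      have hd : y - W.toAffine.negY x y ≠ 0 := sub_ne_zero.mpr hy
      have hE := (equation_iff' ..).mp h.1
      have hs := slope_of_Y_ne rfl hy (W := W.toAffine)
      set ℓ := W.toAffine.slope x x y y with hℓ
      rw [eq_div_iff hd] at hs
      refine ⟨(y - W.toAffine.negY x y) ^ 2, pow_ne_zero 2 hd, fun i ↦ ?_⟩
      simp only [negY] at hs ⊢
      fin_cases i
      · simp [addSubMap, addX, b₄, b₆, b₈]
        have h2 : (ℓ * (y - (-y - W.a₁ * x - W.a₃))) ^ 2 =
            (3 * x ^ 2 + 2 * W.a₂ * x + W.a₄ - W.a₁ * y) ^ 2 := by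
          rw [hs]
        grind
      · simp [addSubMap, b₂, b₄, b₆]
        linear_combination -4 * hE
      · simp [addSubMap]
        ring
  rcases P with _ | ⟨x₁, y₁, h₁⟩
  · refine ⟨1, one_ne_zero, fun i ↦ ?_⟩
    rw [← zero_def, zero_add, zero_sub, sym2x_neg_right]
    rcases Q with _ | ⟨x, y, h⟩
    · rw [← zero_def]
      fin_cases i <;> simp [addSubMap]
    · fin_cases i <;> simp [addSubMap] <;> ring
  rcases Q with _ | ⟨x₂, y₂, h₂⟩
  · refine ⟨1, one_ne_zero, fun i ↦ ?_⟩
    rw [← zero_def, add_zero, sub_zero]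
    fin_cases i <;> simp [addSubMap] <;> ring
  by_cases hx : x₁ = x₂
  · rcases X_eq_iff (h₁ := h₁) (h₂ := h₂) |>.mp hx with h | h
    · rw [h, sub_self]
      exact hself _
    · rw [h, neg_add_cancel, ← neg_add', sym2x_neg_right, sym2x_neg_left, sym2x_comm 0]
      exact hself _
  · refine ⟨(x₁ - x₂) ^ 2, pow_ne_zero 2 (sub_ne_zero.mpr hx), fun i ↦ ?_⟩
    have hd : x₁ - x₂ ≠ 0 := sub_ne_zero.mpr hx
    have hE₁ := (equation_iff' ..).mp h₁.1
    have hE₂ := (equation_iff' ..).mp h₂.1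
    have hs := slope_of_X_ne (W := W.toAffine) (y₁ := y₁) (y₂ := y₂) hx
    have hs' := slope_of_X_ne (W := W.toAffine) (y₁ := y₁) (y₂ := W.toAffine.negY x₂ y₂) hx
    rw [sub_eq_add_neg (some ..), neg_some, add_of_X_ne hx, add_of_X_ne hx, sym2x_some_some,
      sym2x_some_some]
    set ℓ := W.toAffine.slope x₁ x₂ y₁ y₂
    set m := W.toAffine.slope x₁ x₂ y₁ (W.toAffine.negY x₂ y₂)
    rw [eq_div_iff hd] at hs hs'
    simp only [negY] at hs'
    fin_cases i
    · simp [addSubMap, addX]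
      have hB₁ : (x₁ - x₂) ^ 2 * (ℓ ^ 2 + W.a₁ * ℓ - W.a₂ - x₁ - x₂) = (y₁ - y₂) ^ 2 +
        W.a₁ * (y₁ - y₂) * (x₁ - x₂) - (W.a₂ + x₁ + x₂) * (x₁ - x₂) ^ 2 := by
        rw [← hs]; ring
      have hB₂ : (x₁ - x₂) ^ 2 * (m ^ 2 + W.a₁ * m - W.a₂ - x₁ - x₂) =
        (y₁ - (-y₂ - W.a₁ * x₂ - W.a₃)) ^ 2 +
        W.a₁ * (y₁ - (-y₂ - W.a₁ * x₂ - W.a₃)) * (x₁ - x₂) - (W.a₂ + x₁ + x₂) * (x₁ - x₂) ^ 2 := by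
        rw [← hs']; ring
      apply mul_left_cancel₀ (pow_ne_zero 2 hd)
      trans ((x₁ - x₂) ^ 2 * (ℓ ^ 2 + W.a₁ * ℓ - W.a₂ - x₁ - x₂)) *
        ((x₁ - x₂) ^ 2 * (m ^ 2 + W.a₁ * m - W.a₂ - x₁ - x₂))
      · rw [hB₁, hB₂, b₄, b₆, b₈]
        have hpp : (y₁ - y₂) * (y₁ - (-y₂ - W.a₁ * x₂ - W.a₃)) = (x₁ - x₂) *
            (x₁ ^ 2 + x₁ * x₂ + x₂ ^ 2 + W.a₂ * (x₁ + x₂) + W.a₄ - W.a₁ * y₁) := by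
          linear_combination hE₁ - hE₂
        clear hB₁ hB₂ hs hs'
        grind
      · ring
    · simp [addSubMap, addX, b₂, b₄, b₆]
      have h1 : (ℓ * (x₁ - x₂)) ^ 2 = (y₁ - y₂) ^ 2 := by rw [hs]
      have h2 : (m * (x₁ - x₂)) ^ 2 = (y₁ - (-y₂ - W.a₁ * x₂ - W.a₃)) ^ 2 := by rw [hs']
      grind
    · simp [addSubMap]
      ring

end WeierstrassCurve.Affine.Point

section PolynomialTuples

variable {k : Type*} [Field k]

/-- The degree of a tuple of polynomials: the maximum of the degrees of its entries. -/
noncomputable def tupleDegree {n : ℕ} (v : Fin n → k[X]) : ℕ :=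
  Finset.univ.sup fun i ↦ (v i).natDegree

theorem natDegree_le_tupleDegree {n : ℕ} (v : Fin n → k[X]) (i : Fin n) :
    (v i).natDegree ≤ tupleDegree v :=
  Finset.le_sup (f := fun i ↦ (v i).natDegree) (Finset.mem_univ i)

theorem tupleDegree_pair (a b : k[X]) :
    tupleDegree ![a, b] = max a.natDegree b.natDegree := by
  rw [tupleDegree, Fin.univ_succ, Finset.sup_cons]
  simp

theorem tupleDegree_le_iff {n : ℕ} {v : Fin n → k[X]} {d : ℕ} :
    tupleDegree v ≤ d ↔ ∀ i, (v i).natDegree ≤ d := by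
  simp [tupleDegree, Finset.sup_le_iff]

theorem tupleDegree_le_of_proportional {n : ℕ} {v w : Fin n → k[X]}
    (hv : Ideal.span (Set.range v) = ⊤) (hw : Ideal.span (Set.range w) = ⊤)
    (h : ∀ i j, v i * w j = v j * w i) : tupleDegree v ≤ tupleDegree w := by
  have key : ∀ {v w : Fin n → k[X]}, Ideal.span (Set.range v) = ⊤ →
      (∀ i j, v i * w j = v j * w i) → ∃ t, ∀ j, w j = v j * t := by
    intro v w hv h
    obtain ⟨r, hr⟩ := (Ideal.mem_span_range_iff_exists_fun (x := (1 : k[X]))).mp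
      (hv ▸ Submodule.mem_top)
    refine ⟨∑ i, r i * w i, fun j ↦ ?_⟩
    calc w j = (∑ i, r i * v i) * w j := by rw [hr, one_mul]
      _ = v j * ∑ i, r i * w i := by
        rw [Finset.sum_mul, Finset.mul_sum]
        exact Finset.sum_congr rfl fun i _ ↦ by linear_combination r i * h i j
  obtain ⟨t, ht⟩ := key hv h
  obtain ⟨t', ht'⟩ := key (w := v) hw fun i j ↦ by linear_combination h j i
  refine tupleDegree_le_iff.mpr fun i ↦ ?_
  rcases eq_or_ne (w i) 0 with h0 | h0
  · rw [ht' i, h0, zero_mul, natDegree_zero]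
    exact Nat.zero_le _
  · exact (natDegree_le_of_dvd ⟨t, ht i⟩ h0).trans (natDegree_le_tupleDegree w i)

theorem tupleDegree_eq_of_proportional {n : ℕ} {v w : Fin n → k[X]}
    (hv : Ideal.span (Set.range v) = ⊤) (hw : Ideal.span (Set.range w) = ⊤)
    (h : ∀ i j, v i * w j = v j * w i) : tupleDegree v = tupleDegree w :=
  (tupleDegree_le_of_proportional hv hw h).antisymm <|
    tupleDegree_le_of_proportional hw hv fun i j ↦ by linear_combination h j i

/-- The symmetric product of two pairs, viewed as linear forms. -/
noncomputable def symProd {R : Type*} [CommRing R] (v w : Fin 2 → R) : Fin 3 → R :=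
  ![v 0 * w 0, v 0 * w 1 + v 1 * w 0, v 1 * w 1]

theorem span_symProd {v w : Fin 2 → k[X]} (hv : Ideal.span (Set.range v) = ⊤)
    (hw : Ideal.span (Set.range w) = ⊤) : Ideal.span (Set.range (symProd v w)) = ⊤ := by
  by_contra hne
  obtain ⟨M, hM, hle⟩ := Ideal.exists_le_maximal _ hne
  have hp := hM.isPrime
  have h0 : v 0 * w 0 ∈ M := hle (Ideal.subset_span ⟨0, rfl⟩)
  have h1 : v 0 * w 1 + v 1 * w 0 ∈ M := hle (Ideal.subset_span ⟨1, rfl⟩)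
  have h2 : v 1 * w 1 ∈ M := hle (Ideal.subset_span ⟨2, rfl⟩)
  have key : ∀ {u : Fin 2 → k[X]}, Ideal.span (Set.range u) = ⊤ → u 0 ∈ M → u 1 ∈ M → False := by
    intro u hu h0 h1
    refine hM.ne_top (top_le_iff.mp (hu ▸ Ideal.span_le.mpr ?_))
    rintro _ ⟨i, rfl⟩
    fin_cases i <;> assumption
  rcases hp.mem_or_mem h0 with hv0 | hw0
  · rcases hp.mem_or_mem h2 with hv1 | hw1
    · exact key hv hv0 hv1
    · rw [M.add_mem_iff_right (M.mul_mem_left _ hw1)] at h1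
      exact (hp.mem_or_mem h1).elim (key hv hv0) fun h ↦ key hw h hw1
  · rcases hp.mem_or_mem h2 with hv1 | hw1
    · rw [M.add_mem_iff_left (M.mul_mem_right _ hv1)] at h1
      exact (hp.mem_or_mem h1).elim (fun h ↦ key hv h hv1) (key hw hw0)
    · exact key hw hw0 hw1

theorem exists_coeff_tupleDegree_ne_zero {n : ℕ} {v : Fin n → k[X]} (hv : v ≠ 0) :
    ∃ i, (v i).coeff (tupleDegree v) ≠ 0 := by
  obtain ⟨j, hj⟩ := Function.ne_iff.mp hv
  obtain ⟨i, -, hi⟩ := Finset.exists_mem_eq_sup Finset.univ ⟨j, Finset.mem_univ j⟩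
    fun i ↦ (v i).natDegree
  change tupleDegree v = _ at hi
  by_cases h0 : v i = 0
  · refine ⟨j, ?_⟩
    have hd : tupleDegree v = (v j).natDegree := by
      have := natDegree_le_tupleDegree v j
      rw [h0, natDegree_zero] at hi
      omega
    rw [hd]
    exact leadingCoeff_ne_zero.mpr hj
  · exact ⟨i, by rw [hi]; exact leadingCoeff_ne_zero.mpr h0⟩

theorem tupleDegree_symProd {v w : Fin 2 → k[X]} (hv : v ≠ 0) (hw : w ≠ 0) :
    tupleDegree (symProd v w) = tupleDegree v + tupleDegree w := by
  have hmul : ∀ i j, (v i * w j).natDegree ≤ tupleDegree v + tupleDegree w := fun i j ↦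
    natDegree_mul_le_of_le (natDegree_le_tupleDegree v i) (natDegree_le_tupleDegree w j)
  have hcoeff : ∀ i j, (v i * w j).coeff (tupleDegree v + tupleDegree w) =
      (v i).coeff (tupleDegree v) * (w j).coeff (tupleDegree w) := fun i j ↦
    coeff_mul_add_eq_of_natDegree_le (natDegree_le_tupleDegree v i) (natDegree_le_tupleDegree w j)
  refine le_antisymm (tupleDegree_le_iff.mpr fun i ↦ ?_) ?_
  · fin_cases i
    · exact hmul 0 0
    · exact natDegree_add_le_of_degree_le (hmul 0 1) (hmul 1 0)
    · exact hmul 1 1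
  · by_contra! hlt
    have hzero : ∀ i, (symProd v w i).coeff (tupleDegree v + tupleDegree w) = 0 := fun i ↦
      coeff_eq_zero_of_natDegree_lt ((natDegree_le_tupleDegree _ i).trans_lt hlt)
    have h0 := hzero 0
    have h1 := hzero 1
    have h2 := hzero 2
    simp only [symProd, Matrix.cons_val_zero, Matrix.cons_val_one, Matrix.cons_val, coeff_add,
      hcoeff, mul_eq_zero] at h0 h1 h2
    obtain ⟨i, hi⟩ := exists_coeff_tupleDegree_ne_zero hv
    obtain ⟨j, hj⟩ := exists_coeff_tupleDegree_ne_zero hw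
    fin_cases i <;> fin_cases j <;> simp at hi hj <;> grind

theorem natDegree_aeval_le_of_isHomogeneous {n d m : ℕ} {p : MvPolynomial (Fin n) k}
    (hp : p.IsHomogeneous d) {v : Fin n → k[X]} (hv : tupleDegree v ≤ m) :
    (MvPolynomial.aeval v p).natDegree ≤ d * m := by
  rw [MvPolynomial.aeval_def, MvPolynomial.eval₂_eq']
  refine natDegree_sum_le_of_forall_le _ _ fun s hs ↦ ?_
  have hd : ∑ i, s i = d := by
    have := hp (MvPolynomial.mem_support_iff.mp hs)
    simpa [Finsupp.weight_apply, Finsupp.sum_fintype] using this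
  refine (natDegree_C_mul_le _ _).trans ((natDegree_prod_le _ _).trans ?_)
  rw [← hd, Finset.sum_mul]
  exact Finset.sum_le_sum fun i _ ↦ natDegree_pow_le_of_le _ (tupleDegree_le_iff.mp hv i)

end PolynomialTuples

namespace WeierstrassCurve

variable {k : Type*} [Field k] (W : WeierstrassCurve k)

theorem map_addSubMap {S : Type*} [CommRing S] (f : k →+* S) (i : Fin 3) :
    (W.map f).addSubMap i = MvPolynomial.map f (W.addSubMap i) := by
  fin_cases i <;> simp [addSubMap] <;> simp only [map_ofNat]

theorem map_addSubMapCoeff {S : Type*} [CommRing S] (f : k →+* S) (i : Fin 3 × Fin 3) :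
    (W.map f).addSubMapCoeff i = MvPolynomial.map f (W.addSubMapCoeff i) := by
  obtain ⟨i, j⟩ := i
  fin_cases i <;> fin_cases j <;>
    simp only [addSubMapCoeff, Function.uncurry_apply_pair, Fin.zero_eta, Fin.mk_one,
      Fin.reduceFinMk, Matrix.cons_val_zero, Matrix.cons_val_one, Matrix.cons_val, map_add, map_sub,
      map_mul, map_pow, map_neg, MvPolynomial.map_C, MvPolynomial.map_X, map_b₂, map_b₄, map_b₆,
      map_b₈, map_ofNat]

variable [W.IsElliptic] (v : Fin 3 → k[X])

theorem sum_aeval_addSubMapCoeff_mul (i : Fin 3) :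
    ∑ j, MvPolynomial.aeval v (MvPolynomial.C (↑W.Δ'⁻¹ : k) * W.addSubMapCoeff (i, j)) *
      MvPolynomial.aeval v (W.addSubMap j) = v i ^ 4 := by
  rw [← addSubMapCoeff_condition (W.map (C : k →+* k[X])) v i]
  refine Finset.sum_congr rfl fun j _ ↦ ?_
  rw [map_addSubMap, map_addSubMapCoeff, MvPolynomial.eval_map, MvPolynomial.aeval_def]
  simp [MvPolynomial.eval_map, MvPolynomial.aeval_def]

theorem span_addSubMap (hv : Ideal.span (Set.range v) = ⊤) :
    Ideal.span (Set.range fun i ↦ MvPolynomial.aeval v (W.addSubMap i)) = ⊤ := by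
  refine top_le_iff.mp ((Ideal.span_pow_eq_top _ hv 4).symm.trans_le (Ideal.span_le.mpr ?_))
  rintro _ ⟨_, ⟨i, rfl⟩, rfl⟩
  simp only [← W.sum_aeval_addSubMapCoeff_mul v i]
  exact Ideal.sum_mem _ fun j _ ↦ Ideal.mul_mem_left _ _ (Ideal.subset_span ⟨j, rfl⟩)

theorem tupleDegree_addSubMap :
    tupleDegree (fun i ↦ MvPolynomial.aeval v (W.addSubMap i)) = 2 * tupleDegree v := by
  refine le_antisymm (tupleDegree_le_iff.mpr fun i ↦
    natDegree_aeval_le_of_isHomogeneous (W.isHomogeneous_addSubMap i) le_rfl) ?_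
  set e := tupleDegree fun i ↦ MvPolynomial.aeval v (W.addSubMap i) with he
  have key : ∀ i, 4 * (v i).natDegree ≤ 2 * tupleDegree v + e := fun i ↦ by
    rw [← natDegree_pow, ← W.sum_aeval_addSubMapCoeff_mul v i]
    exact natDegree_sum_le_of_forall_le _ _ fun j _ ↦ natDegree_mul_le_of_le
      (natDegree_aeval_le_of_isHomogeneous ((W.isHomogeneous_addSubMapCoeff _).C_mul _) le_rfl)
      (natDegree_le_tupleDegree (fun i ↦ MvPolynomial.aeval v (W.addSubMap i)) j)
  obtain ⟨i, -, hi⟩ := Finset.exists_mem_eq_sup (Finset.univ : Finset (Fin 3)) Finset.univ_nonempty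
    fun i ↦ (v i).natDegree
  change tupleDegree v = _ at hi
  have := key i
  omega

end WeierstrassCurve

section Height

open WeierstrassCurve WeierstrassCurve.Affine

variable {k K : Type*} [Field k] [Field K] [Algebra k[X] K]

theorem exists_isCoprime_of_mul_eq {R L : Type*} [EuclideanDomain R] [Field L]
    [Algebra R L] [FaithfulSMul R L] {z : L} {a b : R} (hb : b ≠ 0)
    (h : algebraMap R L a = algebraMap R L b * z) :
    ∃ a' b' : R, IsCoprime a' b' ∧ algebraMap R L a' = algebraMap R L b' * z := by
  classical
  let _ := EuclideanDomain.gcdMonoid R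
  have hg : GCDMonoid.gcd a b ≠ 0 := fun h0 ↦ hb ((gcd_eq_zero_iff _ _).mp h0).2
  refine ⟨a / GCDMonoid.gcd a b, b / GCDMonoid.gcd a b, isCoprime_div_gcd_div_gcd hb, ?_⟩
  apply mul_left_cancel₀ (a := algebraMap R L (GCDMonoid.gcd a b)) (by simpa using hg)
  rw [← mul_assoc, ← map_mul, ← map_mul,
    EuclideanDomain.mul_div_cancel' hg (GCDMonoid.gcd_dvd_left a b),
    EuclideanDomain.mul_div_cancel' hg (GCDMonoid.gcd_dvd_right a b), h]

theorem WeierstrassCurve.eval_smul_addSubMap {R : Type*} [CommRing R] (W : WeierstrassCurve R)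
    (c : R) (x : Fin 3 → R) (i : Fin 3) :
    (W.addSubMap i).eval (c • x) = c ^ 2 * (W.addSubMap i).eval x := by
  fin_cases i <;> simp [addSubMap] <;> ring

namespace WeierstrassCurve.Affine.Point

section Odd

variable {k K : Type*} [Field k] [Field K] [Algebra k K] [DecidableEq K] {W : WeierstrassCurve k}

variable (W) in
/-- The subgroup of points on which an endomorphism `σ` of the field acts as negation. -/
noncomputable def oddSubgroup (σ : K →ₐ[k] K) : AddSubgroup (W⁄K).toAffine.Point :=
  (map (W' := W) σ + AddMonoidHom.id _).ker

theorem mem_oddSubgroup {σ : K →ₐ[k] K} {P : (W⁄K).toAffine.Point} :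
    P ∈ oddSubgroup W σ ↔ map (W' := W) σ P = -P := by
  simp [oddSubgroup, AddMonoidHom.mem_ker, eq_neg_iff_add_eq_zero]

end Odd

/-- A pair of coprime polynomials representing the `x`-coordinate of a point in `ℙ¹(k(X))`. -/
structure IsPrimitiveRep {V : Affine K} (v : Fin 2 → k[X]) (P : V.Point) : Prop where
  span_eq_top : Ideal.span (Set.range v) = ⊤
  cross : algebraMap k[X] K (v 0) * P.xRep 1 = algebraMap k[X] K (v 1) * P.xRep 0

theorem span_range_pair {R : Type*} [CommRing R] {v : Fin 2 → R} :
    Ideal.span (Set.range v) = ⊤ ↔ IsCoprime (v 0) (v 1) := by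
  rw [Ideal.eq_top_iff_one, Ideal.mem_span_range_iff_exists_fun]
  simp only [Fin.sum_univ_two]
  exact ⟨fun ⟨c, hc⟩ ↦ ⟨c 0, c 1, hc⟩, fun ⟨a, b, h⟩ ↦ ⟨![a, b], by simpa using h⟩⟩

theorem IsPrimitiveRep.ne_zero {V : Affine K} {v : Fin 2 → k[X]} {P : V.Point}
    (h : IsPrimitiveRep v P) : v ≠ 0 := by
  rintro rfl
  exact not_isCoprime_zero_zero (span_range_pair.mp h.span_eq_top)

variable [FaithfulSMul k[X] K]

theorem IsPrimitiveRep.exists_eq_mul {V : Affine K} {v : Fin 2 → k[X]} {P : V.Point}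
    (h : IsPrimitiveRep v P) :
    ∃ c : K, c ≠ 0 ∧ ∀ i, algebraMap k[X] K (v i) = c * P.xRep i := by
  have hinj := FaithfulSMul.algebraMap_injective k[X] K
  have hne : v 0 = 0 → v 1 = 0 → False := fun h0 h1 ↦
    h.ne_zero (by ext i; fin_cases i <;> simp [h0, h1])
  have hc := h.cross
  rcases P with _ | ⟨x, y, hP⟩
  · rw [← zero_def] at hc ⊢
    replace hc : v 1 = 0 := by simpa using hc.symm
    refine ⟨algebraMap k[X] K (v 0), fun h0 ↦ hne ?_ hc, fun i ↦ ?_⟩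
    · simpa using h0
    · fin_cases i <;> simp [hc]
  · simp at hc
    refine ⟨algebraMap k[X] K (v 1), fun h0 ↦ hne ?_ (by simpa using h0), fun i ↦ ?_⟩
    · simpa [h0] using hc
    · fin_cases i <;> simp [hc]

theorem IsPrimitiveRep.tupleDegree_eq {V : Affine K} {v w : Fin 2 → k[X]} {P : V.Point}
    (hv : IsPrimitiveRep v P) (hw : IsPrimitiveRep w P) : tupleDegree v = tupleDegree w := by
  obtain ⟨c, -, hc⟩ := hv.exists_eq_mul
  obtain ⟨d, -, hd⟩ := hw.exists_eq_mul
  refine tupleDegree_eq_of_proportional hv.span_eq_top hw.span_eq_top fun i j ↦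
    FaithfulSMul.algebraMap_injective k[X] K ?_
  rw [map_mul, map_mul, hc, hc, hd, hd]
  ring

variable [Algebra k K] [DecidableEq K] {W : WeierstrassCurve k}

theorem exists_isPrimitiveRep {σ : K →ₐ[k] K}
    (hσ : ∀ z, σ z = z → ∃ a b : k[X], b ≠ 0 ∧ algebraMap k[X] K a = algebraMap k[X] K b * z)
    {P : (W⁄K).toAffine.Point} (hP : P ∈ oddSubgroup W σ) :
    ∃ v : Fin 2 → k[X], IsPrimitiveRep v P := by
  classical
  rw [mem_oddSubgroup] at hP
  rcases P with _ | ⟨x, y, h⟩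
  · exact ⟨![1, 0], span_range_pair.mpr (by simp [isCoprime_one_left]), by simp [← zero_def]⟩
  · rw [map_some, neg_some, some.injEq] at hP
    obtain ⟨a, b, hb, hab⟩ := hσ x hP.1
    obtain ⟨a', b', hco, hab'⟩ := exists_isCoprime_of_mul_eq hb hab
    exact ⟨![a', b'], span_range_pair.mpr (by simpa using hco), by simpa using hab'⟩

variable [IsScalarTower k k[X] K] [W.IsElliptic]

/-- The exact parallelogram law for the degree of the `x`-coordinate on a constant curve. -/
theorem IsPrimitiveRep.tupleDegree_add_tupleDegree {P Q : (W⁄K).toAffine.Point}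
    {v w s d : Fin 2 → k[X]} (hv : IsPrimitiveRep v P) (hw : IsPrimitiveRep w Q)
    (hs : IsPrimitiveRep s (P + Q)) (hd : IsPrimitiveRep d (P - Q)) :
    tupleDegree s + tupleDegree d = 2 * tupleDegree v + 2 * tupleDegree w := by
  have hinj := FaithfulSMul.algebraMap_injective k[X] K
  have hsym {v w : Fin 2 → k[X]} {P Q : (W⁄K).toAffine.Point} (hv : IsPrimitiveRep v P)
      (hw : IsPrimitiveRep w Q) :
      ∃ c : K, c ≠ 0 ∧ ∀ i, algebraMap k[X] K (symProd v w i) = c * P.sym2x Q i := by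
    obtain ⟨c, hc0, hc⟩ := hv.exists_eq_mul
    obtain ⟨d, hd0, hd⟩ := hw.exists_eq_mul
    refine ⟨c * d, mul_ne_zero hc0 hd0, fun i ↦ ?_⟩
    fin_cases i <;> simp [symProd, sym2x, hc, hd] <;> ring
  obtain ⟨c, hc0, hc⟩ := hsym hv hw
  obtain ⟨e, he0, he⟩ := hsym hs hd
  have : (W⁄K).IsElliptic := inferInstanceAs (W.map (algebraMap k K)).IsElliptic
  obtain ⟨u, -, hu⟩ := exists_addSubMap_sym2x (W⁄K) P Q
  have key : ∀ i, algebraMap k[X] K (MvPolynomial.aeval (symProd v w) (W.addSubMap i)) =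
      c ^ 2 * u * (P + Q).sym2x (P - Q) i := fun i ↦ by
    have hcomp : (algebraMap k[X] K ∘ symProd v w) = c • P.sym2x Q := by
      ext i
      simp [hc]
    have hmap : (W⁄K).addSubMap i = MvPolynomial.map (algebraMap k K) (W.addSubMap i) :=
      W.map_addSubMap _ i
    rw [mul_assoc, ← hu, ← eval_smul_addSubMap, ← MvPolynomial.aeval_algebraMap_apply,
      hmap, MvPolynomial.eval_map, ← MvPolynomial.aeval_def]
    exact congrArg (fun x ↦ MvPolynomial.aeval x (W.addSubMap i)) hcomp
  rw [← mul_add, ← tupleDegree_symProd hv.ne_zero hw.ne_zero,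
    ← tupleDegree_symProd hs.ne_zero hd.ne_zero, ← W.tupleDegree_addSubMap]
  refine (tupleDegree_eq_of_proportional (W.span_addSubMap _ <|
    span_symProd hv.span_eq_top hw.span_eq_top) (span_symProd hs.span_eq_top hd.span_eq_top)
    fun i j ↦ hinj ?_).symm
  rw [map_mul, map_mul, key, key, he, he]
  ring

/-- An odd point of degree one bounds the trace of any other odd point. -/
theorem sq_le_four_mul_of_isPrimitiveRep {σ : K →ₐ[k] K}
    (hσ : ∀ z, σ z = z → ∃ a b : k[X], b ≠ 0 ∧ algebraMap k[X] K a = algebraMap k[X] K b * z)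
    {G P : (W⁄K).toAffine.Point} (hG : G ∈ oddSubgroup W σ) (hP : P ∈ oddSubgroup W σ)
    {v w s : Fin 2 → k[X]} (hv : IsPrimitiveRep v G) (hw : IsPrimitiveRep w P)
    (hs : IsPrimitiveRep s (P - G)) (hdeg : tupleDegree v = 1) {a : ℤ}
    (ha : (tupleDegree s : ℤ) = tupleDegree w + 1 - a) : a ^ 2 ≤ 4 * tupleDegree w := by
  choose r hr using fun Q : oddSubgroup W σ ↦ exists_isPrimitiveRep hσ Q.2
  refine sq_le_four_mul_of_parallelogram (fun Q ↦ (tupleDegree (r Q) : ℤ)) (fun _ ↦ by positivity)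
    (fun u v ↦ ?_) (g := ⟨G, hG⟩) (p := ⟨P, hP⟩) ?_ ?_ ?_
  · exact_mod_cast (hr u).tupleDegree_add_tupleDegree (hr v) (hr (u + v)) (hr (u - v))
  · exact_mod_cast ((hr ⟨G, hG⟩).tupleDegree_eq hv).trans hdeg
  · exact_mod_cast (hr ⟨P, hP⟩).tupleDegree_eq hw
  · rw [← ha]
    exact_mod_cast (hr (⟨P, hP⟩ - ⟨G, hG⟩)).tupleDegree_eq hs

end WeierstrassCurve.Affine.Point

end Height

section Dickson

universe u

variable {R : Type u} [CommRing R]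

theorem dickson_add_mul_eq_pow_add_pow {S : Type*} [CommRing S] (φ : R →+* S) {t n : R} {α β : S}
    (hadd : φ t = α + β) (hmul : φ n = α * β) (m : ℕ) :
    φ ((dickson 1 n m).eval t) = α ^ m + β ^ m := by
  induction m using Nat.twoStepInduction with
  | zero => simp [map_ofNat, one_add_one_eq_two]; norm_num
  | one => simp [hadd]
  | more m ih₁ ih₂ =>
    simp only [dickson_add_two, eval_sub, eval_mul, eval_X, eval_C, map_sub, map_mul, ih₁, ih₂,
      hadd, hmul]
    ring

/-- The powers of a root of a monic quadratic `Y ^ 2 - t Y + n`, in terms of the root. -/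
theorem exists_pow_eq_add_mul (t n : R) (m : ℕ) :
    ∃ p r : R, (∀ {S : Type u} [CommRing S] (φ : R →+* S) (α : S), α ^ 2 = φ t * α - φ n →
      α ^ m = φ p + φ r * α) ∧ (dickson 1 n m).eval t = 2 * p + r * t ∧
      (dickson 1 n (m + 1)).eval t = -2 * r * n + (p + r * t) * t ∧
      n ^ m = p ^ 2 + p * r * t + r ^ 2 * n := by
  induction m with
  | zero => exact ⟨1, 0, by norm_num⟩
  | succ m ih =>
    obtain ⟨p, r, h₁, h₂, h₃, h₄⟩ := ih
    refine ⟨-r * n, p + r * t, fun φ α hα ↦ ?_, ?_, ?_, ?_⟩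
    · rw [pow_succ, h₁ φ α hα]
      simp only [map_mul, map_add, map_neg]
      linear_combination φ r * hα
    · rw [h₃]
      ring
    · rw [dickson_add_two, eval_sub, eval_mul, eval_mul, eval_X, eval_C, h₂, h₃]
      ring
    · rw [pow_succ, h₄]
      ring

theorem dickson_eval_of_eq_zero (t : R) {m : ℕ} (hm : m ≠ 0) :
    (dickson 1 (0 : R) m).eval t = t ^ m := by
  obtain ⟨m, rfl⟩ := Nat.exists_eq_succ_of_ne_zero hm
  induction m with
  | zero => simp
  | succ m ih => simp [dickson_add_two, ih, pow_succ']

theorem dvd_eval_dickson {d t n : R} (ht : d ∣ t) (hn : d ∣ n) (m : ℕ) :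
    d ∣ (dickson 1 n (m + 1)).eval t := by
  induction m using Nat.twoStepInduction with
  | zero => simpa
  | one => simpa [dickson_add_two] using dvd_sub (ht.mul_left _) (hn.mul_right _)
  | more m ih₁ ih₂ =>
    rw [dickson_add_two]
    simpa using dvd_sub (ht.mul_right _) (hn.mul_right _)

theorem sq_dvd_eval_dickson {d t n : R} (ht : d ∣ t) (hn : d ∣ n) (m : ℕ) :
    d ^ 2 ∣ (dickson 1 n (m + 3)).eval t := by
  rw [dickson_add_two, sq, eval_sub, eval_mul, eval_mul, eval_X, eval_C]
  exact dvd_sub (mul_dvd_mul ht (dvd_eval_dickson ht hn _))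
    (mul_dvd_mul hn (dvd_eval_dickson ht hn m))

theorem map_eval_dickson {S : Type*} [CommRing S] (φ : R →+* S) (t n : R) (m : ℕ) :
    φ ((dickson 1 n m).eval t) = (dickson 1 (φ n) m).eval (φ t) := by
  rw [← map_dickson, eval_map, eval₂_hom]

theorem natDegree_eval_dickson_le {t n : R[X]} (ht : t.natDegree ≤ 1) (hn : n.natDegree ≤ 3)
    (m : ℕ) : 2 * ((dickson 1 n m).eval t).natDegree ≤ 3 * m := by
  induction m using Nat.twoStepInduction with
  | zero =>
    norm_num
  | one => simp; omega
  | more m ih₁ ih₂ =>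
    rw [dickson_add_two]
    simp only [eval_sub, eval_mul, eval_X, eval_C]
    have h₁ := natDegree_sub_le (t * (dickson 1 n (m + 1)).eval t) (n * (dickson 1 n m).eval t)
    have h₂ := natDegree_mul_le (p := t) (q := (dickson 1 n (m + 1)).eval t)
    have h₃ := natDegree_mul_le (p := n) (q := (dickson 1 n m).eval t)
    omega

end Dickson

section FrobeniusResultant

/-- The negative of the resultant of `Y ^ 2 - t Y + n` and `Y ^ m - (t - Y)`. -/
noncomputable def frobeniusResultant {R : Type*} [CommRing R] (t n : R) (m : ℕ) : R :=
  (dickson 1 n (m + 1)).eval t - n - n ^ m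

theorem map_frobeniusResultant_eq {R S : Type*} [CommRing R] [CommRing S] (φ : R →+* S) {t n : R}
    {α β : S} (hadd : φ t = α + β) (hmul : φ n = α * β) (m : ℕ) :
    φ (frobeniusResultant t n m) = (α ^ m - β) * (α - β ^ m) := by
  rw [frobeniusResultant, map_sub, map_sub, dickson_add_mul_eq_pow_add_pow φ hadd hmul, map_pow,
    hmul]
  ring

variable {k : Type*} [Field k] [Fintype k]

variable (k) in
theorem X_pow_card_sub_X_eq_prod : (X ^ Fintype.card k - X : k[X]) = ∏ c : k, (X - C c) := by
  have hd := FiniteField.X_pow_card_sub_X_natDegree_eq k (Fintype.one_lt_card (α := k))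
  have h := prod_multiset_X_sub_C_of_monic_of_roots_card_eq
    (p := (X ^ Fintype.card k - X : k[X])) ?_ ?_
  · rw [← h, FiniteField.roots_X_pow_card_sub_X]
    rfl
  · refine monic_X_pow_sub ?_
    rw [degree_X]
    exact_mod_cast Fintype.one_lt_card
  · rw [FiniteField.roots_X_pow_card_sub_X, hd]
    rfl

theorem frobeniusResultant_sub_two_mul (t n : k[X]) (y : k) :
    frobeniusResultant (t - 2 * C y) (n - C y * t + C y ^ 2) (Fintype.card k) =
      frobeniusResultant t n (Fintype.card k) := by
  let L := AlgebraicClosure (FractionRing k[X])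
  let φ : k[X] →+* L := (algebraMap (FractionRing k[X]) L).comp (algebraMap k[X] _)
  have hinj : Function.Injective φ :=
    (algebraMap (FractionRing k[X]) L).injective.comp (IsFractionRing.injective k[X] _)
  obtain ⟨α, hα⟩ := IsAlgClosed.exists_root (X ^ 2 - C (φ t) * X + C (φ n))
    (by rw [show degree _ = 2 by compute_degree!]; norm_num)
  have hα : φ n = α * (φ t - α) := by
    simp only [IsRoot.def, eval_add, eval_sub, eval_pow, eval_mul, eval_X, eval_C] at hα
    linear_combination hα
  have hq (z : L) : (z - φ (C y)) ^ Fintype.card k = z ^ Fintype.card k - φ (C y) := by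
    obtain ⟨p, hp⟩ := CharP.exists k
    have : Fact p.Prime := ⟨CharP.char_is_prime k p⟩
    have : CharP L p := charP_of_injective_ringHom (f := φ.comp C) (hinj.comp C_injective) p
    obtain ⟨n, -, hn⟩ := FiniteField.card k p
    rw [hn, sub_pow_char_pow, ← hn, ← map_pow, ← map_pow, FiniteField.pow_card]
  apply hinj
  rw [map_frobeniusResultant_eq φ (α := α) (β := φ t - α) (by ring) hα,
    map_frobeniusResultant_eq φ (α := α - φ (C y)) (β := φ t - α - φ (C y)), hq, hq]
  · ring
  · rw [map_sub, map_mul, map_ofNat]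
    ring
  · rw [map_add, map_sub, map_mul, map_pow, hα]
    ring

theorem sq_dvd_frobeniusResultant {t n : k[X]} {c : k}
    (h : ∀ y, y ^ 2 - t.eval c * y + n.eval c ≠ 0) :
    (X - C c) ^ 2 ∣ frobeniusResultant t n (Fintype.card k) := by
  obtain ⟨p, r, h₁, h₂, h₃, h₄⟩ := exists_pow_eq_add_mul t n (Fintype.card k)
  let L := AlgebraicClosure k
  obtain ⟨α, hα⟩ := IsAlgClosed.exists_root (X ^ 2 - C (algebraMap k L (t.eval c)) * X +
    C (algebraMap k L (n.eval c))) (by rw [show degree _ = 2 by compute_degree!]; norm_num)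
  simp only [IsRoot.def, eval_add, eval_sub, eval_pow, eval_mul, eval_X, eval_C] at hα
  have hαk (y : k) : algebraMap k L y ≠ α := fun hy ↦ h y <|
    (algebraMap k L).injective <| by simpa [← hy] using hα
  have hpr := h₁ ((algebraMap k L).comp (evalRingHom c)) α
    (by simp only [RingHom.comp_apply, coe_evalRingHom]; linear_combination hα)
  simp only [RingHom.comp_apply, coe_evalRingHom] at hpr
  have hαq : α ^ Fintype.card k ≠ α := fun hq ↦ by
    have := congrArg (eval₂ (algebraMap k L) α) (X_pow_card_sub_X_eq_prod k)
    rw [eval₂_finsetProd] at this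
    simp only [eval₂_sub, eval₂_X_pow, eval₂_X, eval₂_C, hq, sub_self] at this
    obtain ⟨y, -, hy⟩ := Finset.prod_eq_zero_iff.mp this.symm
    exact hαk y (sub_eq_zero.mp hy).symm
  have hroot : (α ^ Fintype.card k) ^ 2 - algebraMap k L (t.eval c) * α ^ Fintype.card k +
    algebraMap k L (n.eval c) = 0 := by
    have := congrArg (FiniteField.frobeniusAlgHom k L) hα
    simpa [map_add, map_sub, map_mul, map_pow] using this
  have hconj : α ^ Fintype.card k = algebraMap k L (t.eval c) - α := by
    have : (α ^ Fintype.card k - α) *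
        (α ^ Fintype.card k - (algebraMap k L (t.eval c) - α)) = 0 := by
      linear_combination hroot - hα
    exact sub_eq_zero.mp ((mul_eq_zero.mp this).resolve_left (sub_ne_zero.mpr hαq))
  have hr : (r + 1).eval c = 0 := by
    by_contra hr
    refine hαk ((t - p).eval c / (r + 1).eval c) ?_
    rw [map_div₀, div_eq_iff ((_root_.map_ne_zero _).mpr hr)]
    simp only [eval_add, eval_sub, eval_one, map_add, map_sub, map_one]
    linear_combination hpr - hconj
  have hp : (p - t).eval c = 0 := (algebraMap k L).injective <| by
    have := congrArg (algebraMap k L) hr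
    simp only [eval_add, eval_sub, eval_one, map_add, map_sub, map_one, map_zero] at this ⊢
    linear_combination hconj - hpr - α * this
  have hp := dvd_iff_isRoot.mpr hp
  have hr := dvd_iff_isRoot.mpr hr
  have : frobeniusResultant t n (Fintype.card k) =
      -((p - t) ^ 2 + (p - t) * (r + 1) * t + (r + 1) ^ 2 * n) := by
    rw [frobeniusResultant, h₃, h₄]
    ring
  rw [this, dvd_neg]
  exact dvd_add (dvd_add (pow_dvd_pow_of_dvd hp 2)
    (((sq (X - C c)) ▸ mul_dvd_mul hp hr).mul_right _))
    ((pow_dvd_pow_of_dvd hr 2).mul_right _)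

theorem not_dvd_frobeniusResultant {t n : k[X]} {c : k} (ht : t.eval c ≠ 0) (hn : n.eval c = 0) :
    ¬ X - C c ∣ frobeniusResultant t n (Fintype.card k) := by
  rw [dvd_iff_isRoot, IsRoot.def, frobeniusResultant, eval_sub, eval_sub, eval_pow, hn,
    ← coe_evalRingHom, map_eval_dickson, coe_evalRingHom, hn,
    dickson_eval_of_eq_zero _ (Nat.succ_ne_zero _), zero_pow Fintype.card_ne_zero]
  simpa using ht

theorem frobeniusResultant_of_double_root {t n : k[X]} {c : k} (ht : t.eval c = 0)
    (hn : n.eval c = 0) (hn' : n.derivative.eval c ≠ 0) :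
    X - C c ∣ frobeniusResultant t n (Fintype.card k) ∧
      ¬ (X - C c) ^ 2 ∣ frobeniusResultant t n (Fintype.card k) := by
  obtain ⟨m, hm⟩ := Nat.exists_eq_add_of_le' (Fintype.one_lt_card (α := k))
  have ht := dvd_iff_isRoot.mpr ht
  have hn := dvd_iff_isRoot.mpr hn
  have hV := sq_dvd_eval_dickson ht hn m
  have hnq : (X - C c) ^ 2 ∣ n ^ Fintype.card k :=
    (pow_dvd_pow_of_dvd hn 2).trans (pow_dvd_pow n Fintype.one_lt_card)
  rw [frobeniusResultant, show Fintype.card k + 1 = m + 3 by omega]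
  have hX : X - C c ∣ (X - C c) ^ 2 := dvd_pow_self _ two_ne_zero
  refine ⟨dvd_sub (dvd_sub (hX.trans hV) hn) (hX.trans hnq), fun h ↦ hn' ?_⟩
  have : (X - C c) ^ 2 ∣ n := by
    convert dvd_sub (dvd_sub hV hnq) h using 1
    ring
  obtain ⟨g, rfl⟩ := this
  simp [derivative_mul, derivative_pow]

end FrobeniusResultant

namespace WeierstrassCurve

section Numerator

variable {k : Type*} [Field k] (W : WeierstrassCurve k)

/-- The sum of the two `y`-coordinates above the generic `x`-coordinate. -/
noncomputable def yTrace : k[X] := -(C W.a₁ * X + C W.a₃)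

/-- The product of the two `y`-coordinates above the generic `x`-coordinate. -/
noncomputable def yNorm : k[X] := -(X ^ 3 + C W.a₂ * X ^ 2 + C W.a₄ * X + C W.a₆)

theorem equation_iff_eval_yTrace {c y : k} :
    W.toAffine.Equation c y ↔ y ^ 2 - W.yTrace.eval c * y + W.yNorm.eval c = 0 := by
  simp only [Affine.equation_iff', yTrace, yNorm, eval_neg, eval_add, eval_mul, eval_C, eval_X,
    eval_pow]
  ring_nf

variable [Fintype k]

/-- The numerator of the `x`-coordinate of the difference between the Frobenius image of the
generic point and the generic point, over the denominator `(X ^ q - X) ^ 2`. -/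
noncomputable def frobeniusSubNum : k[X] :=
  frobeniusResultant W.yTrace W.yNorm (Fintype.card k) -
    (C W.a₂ + X ^ Fintype.card k + X) * (X ^ Fintype.card k - X) ^ 2

theorem pow_dvd_frobeniusSubNum_iff {c : k} {m : ℕ} (hm : m ≤ 2) :
    (X - C c) ^ m ∣ W.frobeniusSubNum ↔
      (X - C c) ^ m ∣ frobeniusResultant W.yTrace W.yNorm (Fintype.card k) := by
  refine dvd_sub_left (Dvd.dvd.mul_left ((pow_dvd_pow _ hm).trans (pow_dvd_pow_of_dvd ?_ 2)) _)
  rw [X_pow_card_sub_X_eq_prod]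
  exact Finset.dvd_prod_of_mem _ (Finset.mem_univ c)

/-- The order of vanishing of the numerator at `c` complements the number of points above `c`. -/
theorem ncard_fiber [W.IsElliptic] (c : k) :
    {y | W.toAffine.Equation c y}.ncard ≤ 2 ∧
      (X - C c) ^ (2 - {y | W.toAffine.Equation c y}.ncard) ∣ W.frobeniusSubNum ∧
      ({y | W.toAffine.Equation c y}.ncard ≠ 0 →
        ¬ (X - C c) ^ (3 - {y | W.toAffine.Equation c y}.ncard) ∣ W.frobeniusSubNum) := by
  rcases {y | W.toAffine.Equation c y}.eq_empty_or_nonempty with h | ⟨y, hy⟩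
  · rw [h, Set.ncard_empty, W.pow_dvd_frobeniusSubNum_iff le_rfl]
    refine ⟨by norm_num, sq_dvd_frobeniusResultant fun y hy ↦ ?_, by simp⟩
    exact h.le (W.equation_iff_eval_yTrace.mpr hy)
  have hy' := W.equation_iff_eval_yTrace.mp hy
  have hset : {y | W.toAffine.Equation c y} = {y, W.yTrace.eval c - y} := by
    ext z
    simp only [Set.mem_ofPred_eq, W.equation_iff_eval_yTrace, Set.mem_insert_iff,
      Set.mem_singleton_iff]
    rw [← sub_eq_zero (a := z), ← sub_eq_zero (a := z), ← mul_eq_zero]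
    exact ⟨fun h ↦ by linear_combination h - hy', fun h ↦ by linear_combination h + hy'⟩
  have hn : (W.yNorm - C y * W.yTrace + C y ^ 2).eval c = 0 := by
    simp only [eval_add, eval_sub, eval_mul, eval_pow, eval_C]
    linear_combination hy'
  rw [hset]
  by_cases ht : (W.yTrace - 2 * C y).eval c = 0
  · have hyy : W.yTrace.eval c - y = y := by
      simp only [eval_sub, eval_mul, eval_ofNat, eval_C] at ht
      linear_combination ht
    rw [hyy, Set.pair_eq_singleton, Set.ncard_singleton,
      W.pow_dvd_frobeniusSubNum_iff (by norm_num), W.pow_dvd_frobeniusSubNum_iff (by norm_num),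
      ← frobeniusResultant_sub_two_mul _ _ y]
    have := frobeniusResultant_of_double_root ht hn fun h ↦ ?_
    · exact ⟨by norm_num, by simpa using this.1, fun _ ↦ this.2⟩
    · have hns := ((W.toAffine.nonsingular_iff' _ _).mp <|
        W.toAffine.equation_iff_nonsingular.mp hy).2
      simp only [yTrace, yNorm, derivative_add, derivative_sub, derivative_neg, derivative_mul,
        derivative_C, derivative_X, derivative_pow, eval_add, eval_sub, eval_neg,
        eval_mul, eval_pow, eval_C, eval_X, eval_ofNat, eval_one, eval_zero] at ht h
      push_cast at h
      rcases hns with hns | hns <;> apply hns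
      · linear_combination h
      · linear_combination -ht
  · have hyy : y ≠ W.yTrace.eval c - y := fun h ↦ ht <| by
      simp only [eval_sub, eval_mul, eval_ofNat, eval_C]
      linear_combination -h
    rw [Set.ncard_pair hyy, W.pow_dvd_frobeniusSubNum_iff (by norm_num),
      W.pow_dvd_frobeniusSubNum_iff (by norm_num), ← frobeniusResultant_sub_two_mul _ _ y]
    exact ⟨le_rfl, by simp, fun _ ↦ by simpa using not_dvd_frobeniusResultant ht hn⟩

theorem natDegree_frobeniusSubNum : W.frobeniusSubNum.natDegree = 2 * Fintype.card k + 1 := by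
  set q := Fintype.card k with hq
  have hq1 : 1 < q := Fintype.one_lt_card
  have ht : W.yTrace.natDegree ≤ 1 := by
    rw [yTrace]
    compute_degree
  have hn : W.yNorm.natDegree ≤ 3 := by
    rw [yNorm]
    compute_degree
  have hV := natDegree_eval_dickson_le ht hn (q + 1)
  have hpow : W.yNorm ^ q = -(X ^ (3 * q) + C W.a₂ * X ^ (2 * q) + C W.a₄ * X ^ q + C W.a₆) := by
    rw [hq, ← FiniteField.expand_card, yNorm]
    simp only [map_neg, map_add, map_mul, map_pow, expand_X, expand_C]
    ring
  have : W.frobeniusSubNum = X ^ (2 * q + 1) + (X ^ (q + 2) + (C W.a₂ * 2) * X ^ (q + 1) +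
      C W.a₄ * X ^ q + C W.a₄ * X + C (2 * W.a₆) + (dickson 1 W.yNorm (q + 1)).eval W.yTrace) := by
    rw [frobeniusSubNum, frobeniusResultant, ← hq, hpow, yNorm]
    simp only [map_mul, map_ofNat]
    ring
  rw [this, natDegree_add_eq_left_of_natDegree_lt, natDegree_X_pow]
  rw [natDegree_X_pow, Nat.lt_succ_iff]
  refine natDegree_add_le_of_degree_le ?_ (by omega)
  compute_degree
  grind

end Numerator

end WeierstrassCurve

namespace WeierstrassCurve

section PointCount

variable {k : Type*} [Field k] [Fintype k] (W : WeierstrassCurve k) [W.IsElliptic]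

theorem card_point_eq_sum_ncard :
    Nat.card W.toAffine.Point = ∑ c : k, {y | W.toAffine.Equation c y}.ncard + 1 := by
  classical
  rw [Nat.card_congr W.toAffine.pointEquiv]
  refine (Finite.card_option (α := {xy : k × k // W.toAffine.Equation xy.1 xy.2})).trans ?_
  congr 1
  rw [Nat.card_congr (β := Σ c : k, {y | W.toAffine.Equation c y})
    ⟨fun z ↦ ⟨z.1.1, z.1.2, z.2⟩, fun z ↦ ⟨(z.1, z.2), z.2.2⟩, fun _ ↦ rfl, fun _ ↦ rfl⟩,
    Nat.card_sigma]
  rfl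

/-- The reduced fraction of the `x`-coordinate of the difference between the Frobenius image of
the generic point and the generic point. -/
theorem exists_isCoprime_frobeniusSub :
    ∃ a b : k[X], IsCoprime a b ∧ a * (X ^ Fintype.card k - X) ^ 2 = b * W.frobeniusSubNum ∧
      max a.natDegree b.natDegree = Nat.card W.toAffine.Point := by
  set n : k → ℕ := fun c ↦ {y | W.toAffine.Equation c y}.ncard
  have hn (c : k) : n c ≤ 2 := (W.ncard_fiber c).1
  have hcop (m : k → ℕ) : Pairwise (Function.onFun IsCoprime fun c ↦ (X - C c) ^ m c) :=
    fun c d h ↦ (isCoprime_X_sub_C_of_isUnit_sub (sub_ne_zero.mpr h).isUnit).pow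
  obtain ⟨a, ha⟩ : ∏ c, (X - C c) ^ (2 - n c) ∣ W.frobeniusSubNum :=
    Finset.prod_dvd_of_coprime ((hcop _).set_pairwise _) fun c _ ↦ (W.ncard_fiber c).2.1
  have hdeg (m : k → ℕ) : (∏ c, (X - C c) ^ m c).natDegree = ∑ c, m c := by
    rw [natDegree_prod_of_monic _ _ fun c _ ↦ (monic_X_sub_C c).pow _]
    simp
  have hmonic (m : k → ℕ) : (∏ c, (X - C c) ^ m c).Monic :=
    monic_prod_of_monic _ _ fun c _ ↦ (monic_X_sub_C c).pow _
  refine ⟨a, ∏ c, (X - C c) ^ n c, IsCoprime.prod_right fun c _ ↦ ?_, ?_, ?_⟩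
  · rcases eq_or_ne (n c) 0 with h0 | h0
    · rw [h0, pow_zero]
      exact isCoprime_one_right
    refine IsCoprime.pow_right (((irreducible_X_sub_C c).coprime_iff_not_dvd.mpr fun h ↦ ?_).symm)
    refine (W.ncard_fiber c).2.2 h0 ?_
    have h3 : 3 - n c = 2 - n c + 1 := by have := hn c; omega
    rw [ha]
    change (X - C c) ^ (3 - n c) ∣ _
    rw [h3, pow_succ]
    exact mul_dvd_mul (Finset.dvd_prod_of_mem (fun c ↦ (X - C c) ^ (2 - n c))
      (Finset.mem_univ c)) h
  · have : (∏ c, (X - C c) ^ (2 - n c)) * ∏ c, (X - C c) ^ n c =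
        (X ^ Fintype.card k - X) ^ 2 := by
      rw [X_pow_card_sub_X_eq_prod, ← Finset.prod_mul_distrib, ← Finset.prod_pow]
      exact Finset.prod_congr rfl fun c _ ↦ by rw [← pow_add, Nat.sub_add_cancel (hn c)]
    rw [← this, ha]
    ring
  · have h := W.natDegree_frobeniusSubNum
    have ha0 : a ≠ 0 := by
      rintro rfl
      rw [ha, mul_zero, natDegree_zero] at h
      omega
    rw [ha, (hmonic _).natDegree_mul' ha0, hdeg] at h
    have hsum : ∑ c, (2 - n c) + ∑ c, n c = 2 * Fintype.card k := by
      rw [← Finset.sum_add_distrib, Finset.sum_congr rfl fun c _ ↦ Nat.sub_add_cancel (hn c)]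
      simp [mul_comm]
    rw [hdeg, card_point_eq_sum_ncard]
    change max _ _ = ∑ c, n c + 1
    omega

end PointCount

end WeierstrassCurve

namespace WeierstrassCurve

section Conjugation

variable {k : Type*} [Field k] (W : WeierstrassCurve k)

theorem eval₂_polynomial {S : Type*} [CommRing S] (φ : k[X] →+* S) (x : S) :
    eval₂ φ x W.toAffine.polynomial = x ^ 2 - φ W.yTrace * x + φ W.yNorm := by
  simp only [Affine.polynomial, eval₂_add, eval₂_sub, eval₂_mul, eval₂_X, eval₂_C, eval₂_X_pow,
    yTrace, yNorm, map_neg]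
  ring

theorem root_sq : (AdjoinRoot.root W.toAffine.polynomial) ^ 2 =
    algebraMap k[X] W.toAffine.CoordinateRing W.yTrace * AdjoinRoot.root W.toAffine.polynomial -
      algebraMap k[X] W.toAffine.CoordinateRing W.yNorm := by
  have h := AdjoinRoot.eval₂_root W.toAffine.polynomial
  rw [eval₂_polynomial, ← AdjoinRoot.algebraMap_eq] at h
  linear_combination h

/-- The nontrivial automorphism of the coordinate ring over the polynomials in `X`. -/
noncomputable def conj : W.toAffine.CoordinateRing →ₐ[k[X]] W.toAffine.CoordinateRing :=
  AdjoinRoot.liftAlgHom W.toAffine.polynomial (Algebra.ofId k[X] W.toAffine.CoordinateRing)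
    (algebraMap k[X] _ W.yTrace - AdjoinRoot.root W.toAffine.polynomial) <| by
      rw [eval₂_polynomial]
      change _ - algebraMap k[X] W.toAffine.CoordinateRing _ * _ +
        algebraMap k[X] W.toAffine.CoordinateRing _ = 0
      linear_combination W.root_sq

theorem conj_root : W.conj (AdjoinRoot.root W.toAffine.polynomial) =
    algebraMap k[X] _ W.yTrace - AdjoinRoot.root W.toAffine.polynomial :=
  AdjoinRoot.liftAlgHom_root ..

theorem conj_conj (z : W.toAffine.CoordinateRing) : W.conj (W.conj z) = z := by
  have : W.conj.comp W.conj = AlgHom.id k[X] _ := AdjoinRoot.algHom_ext <| by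
    rw [AlgHom.comp_apply, conj_root, map_sub, AlgHom.commutes, conj_root, sub_sub_cancel]
    rfl
  exact DFunLike.congr_fun this z

theorem exists_eq_add_mul_root (z : W.toAffine.CoordinateRing) :
    ∃ a b : k[X], z = algebraMap k[X] _ a +
      algebraMap k[X] _ b * AdjoinRoot.root W.toAffine.polynomial := by
  obtain ⟨a, b, h⟩ := Affine.CoordinateRing.exists_smul_basis_eq z
  refine ⟨a, b, ?_⟩
  rw [← h, Algebra.smul_def, Algebra.smul_def, mul_one]
  rfl

theorem exists_mul_conj_eq {z : W.toAffine.CoordinateRing} (hz : z ≠ 0) :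
    ∃ p : k[X], p ≠ 0 ∧ z * W.conj z = algebraMap k[X] _ p := by
  obtain ⟨a, b, h⟩ := W.exists_eq_add_mul_root z
  have key : z * W.conj z = algebraMap k[X] _ (a ^ 2 + a * b * W.yTrace + b ^ 2 * W.yNorm) := by
    rw [h]
    simp only [map_add, map_mul, AlgHom.commutes, conj_root, map_pow]
    linear_combination -(algebraMap k[X] W.toAffine.CoordinateRing b) ^ 2 * W.root_sq
  refine ⟨_, fun h0 ↦ ?_, key⟩
  rw [h0, map_zero] at key
  refine (mul_ne_zero hz fun hc ↦ hz ?_) key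
  rw [← W.conj_conj z, hc, map_zero]

theorem exists_eq_algebraMap_of_conj_eq [W.IsElliptic] {z : W.toAffine.CoordinateRing}
    (hz : W.conj z = z) : ∃ p : k[X], z = algebraMap k[X] _ p := by
  obtain ⟨a, b, h⟩ := W.exists_eq_add_mul_root z
  refine ⟨a, ?_⟩
  suffices hb : b = 0 by rw [h, hb, map_zero, zero_mul, add_zero]
  have h0 : (-(b * W.yTrace)) • (1 : W.toAffine.CoordinateRing) +
      (2 * b) • Affine.CoordinateRing.mk W.toAffine X = 0 := by
    rw [Algebra.smul_def, Algebra.smul_def]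
    change _ + _ * AdjoinRoot.root W.toAffine.polynomial = 0
    simp only [h, map_add, map_mul, AlgHom.commutes, conj_root, map_neg, map_ofNat] at hz ⊢
    linear_combination -hz
  obtain ⟨h1, h2⟩ := Affine.CoordinateRing.smul_basis_eq_zero h0
  by_contra hb
  have h2 : (2 : k) = 0 := by
    have := (mul_eq_zero.mp h2).resolve_right hb
    simpa using congrArg (eval 0) this
  have h1 := (mul_eq_zero.mp (neg_eq_zero.mp h1)).resolve_left hb
  have h3 : W.a₃ = 0 := by simpa [yTrace] using congrArg (eval 0) h1
  have h4 : W.a₁ = 0 := by simpa [yTrace, h3] using congrArg (eval 1) h1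
  refine W.isUnit_Δ.ne_zero ?_
  simp only [Δ, b₂, b₄, b₆, b₈, h3, h4]
  grind

/-- The nontrivial automorphism of the function field over the rational functions in `X`. -/
noncomputable def functionFieldConj : W.toAffine.FunctionField →ₐ[k[X]] W.toAffine.FunctionField :=
  IsFractionRing.liftAlgHom (g := (IsScalarTower.toAlgHom k[X] W.toAffine.CoordinateRing
    W.toAffine.FunctionField).comp W.conj) <|
      (IsFractionRing.injective W.toAffine.CoordinateRing W.toAffine.FunctionField).comp
        (Function.LeftInverse.injective W.conj_conj)

theorem functionFieldConj_algebraMap (z : W.toAffine.CoordinateRing) :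
    W.functionFieldConj (algebraMap _ _ z) = algebraMap _ _ (W.conj z) :=
  IsFractionRing.lift_algebraMap (g := ((IsScalarTower.toAlgHom k[X] W.toAffine.CoordinateRing
    W.toAffine.FunctionField).comp W.conj).toRingHom)
      ((IsFractionRing.injective W.toAffine.CoordinateRing W.toAffine.FunctionField).comp
        (Function.LeftInverse.injective W.conj_conj)) z

theorem exists_of_functionFieldConj_eq [W.IsElliptic] {z : W.toAffine.FunctionField}
    (hz : W.functionFieldConj z = z) : ∃ a b : k[X], b ≠ 0 ∧
      algebraMap k[X] W.toAffine.FunctionField a = algebraMap k[X] _ b * z := by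
  have hinj := IsFractionRing.injective W.toAffine.CoordinateRing W.toAffine.FunctionField
  obtain ⟨r, s, hs, rfl⟩ := IsFractionRing.div_surjective (A := W.toAffine.CoordinateRing) z
  have hs := nonZeroDivisors.ne_zero hs
  obtain ⟨p, hp0, hp⟩ := W.exists_mul_conj_eq hs
  have hs' := (map_ne_zero_iff _ hinj).mpr hs
  have hc : W.conj s ≠ 0 := fun hc ↦ hs (by rw [← W.conj_conj s, hc, map_zero])
  have hc' := (map_ne_zero_iff _ hinj).mpr hc
  obtain ⟨a, ha⟩ := W.exists_eq_algebraMap_of_conj_eq (z := r * W.conj s) <| hinj <| by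
    rw [map_div₀, functionFieldConj_algebraMap, functionFieldConj_algebraMap,
      div_eq_div_iff hc' hs'] at hz
    rw [map_mul, conj_conj, map_mul, map_mul, hz]
  refine ⟨a, p, hp0, ?_⟩
  rw [IsScalarTower.algebraMap_apply k[X] W.toAffine.CoordinateRing, ← ha,
    IsScalarTower.algebraMap_apply k[X] W.toAffine.CoordinateRing, ← hp, map_mul, map_mul]
  field_simp

end Conjugation

end WeierstrassCurve

section Generic

open WeierstrassCurve WeierstrassCurve.Affine WeierstrassCurve.Affine.Point

namespace WeierstrassCurve

theorem map_frobenius_mem_oddSubgroup {k K : Type*} [Field k] [Fintype k] [Field K] [Algebra k K]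
    [DecidableEq K] {W : WeierstrassCurve k} {σ : K →ₐ[k] K} {P : (W⁄K).toAffine.Point}
    (hP : P ∈ oddSubgroup W σ) :
    Point.map (W' := W) (FiniteField.frobeniusAlgHom k K) P ∈ oddSubgroup W σ := by
  rw [mem_oddSubgroup] at hP ⊢
  rw [← map_neg, ← hP]
  rcases P with _ | ⟨x, y, h⟩
  · rfl
  · simp [map_some]

variable {k K : Type*} [Field k] [Field K] [Algebra k K] [Algebra k[X] K]
  [IsScalarTower k k[X] K] {W : WeierstrassCurve k}

theorem algebraMap_yTrace :
    algebraMap k[X] K W.yTrace = -((W⁄K).a₁ * algebraMap k[X] K X + (W⁄K).a₃) := by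
  simp only [yTrace, map_neg, map_add, map_mul, ← algebraMap_eq, ← IsScalarTower.algebraMap_apply]
  rfl

theorem algebraMap_yNorm :
    algebraMap k[X] K W.yNorm = -(algebraMap k[X] K X ^ 3 + (W⁄K).a₂ * algebraMap k[X] K X ^ 2 +
      (W⁄K).a₄ * algebraMap k[X] K X + (W⁄K).a₆) := by
  simp only [yNorm, map_neg, map_add, map_mul, map_pow, ← algebraMap_eq,
    ← IsScalarTower.algebraMap_apply]
  rfl

theorem nonsingular_generic [W.IsElliptic] {y : K}
    (hy : y ^ 2 = algebraMap k[X] K W.yTrace * y - algebraMap k[X] K W.yNorm) :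
    (W⁄K).toAffine.Nonsingular (algebraMap k[X] K X) y := by
  have : (W⁄K).IsElliptic := inferInstanceAs (W.map (algebraMap k K)).IsElliptic
  rw [← Affine.equation_iff_nonsingular, Affine.equation_iff']
  rw [algebraMap_yTrace, algebraMap_yNorm] at hy
  linear_combination hy

variable [DecidableEq K]

theorem generic_mem_oddSubgroup {σ : K →ₐ[k] K}
    (hσX : σ (algebraMap k[X] K X) = algebraMap k[X] K X)
    {y : K} (hσy : σ y = algebraMap k[X] K W.yTrace - y)
    (h : (W⁄K).toAffine.Nonsingular (algebraMap k[X] K X) y) :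
    some (algebraMap k[X] K X) y h ∈ oddSubgroup W σ := by
  rw [mem_oddSubgroup, map_some, neg_some, some.injEq, hσX, hσy, negY, algebraMap_yTrace]
  exact ⟨rfl, by ring⟩

variable [Fintype k] [FaithfulSMul k[X] K] [W.IsElliptic]

theorem isPrimitiveRep_frobenius_sub {y : K}
    (hy : y ^ 2 = algebraMap k[X] K W.yTrace * y - algebraMap k[X] K W.yNorm)
    {a b : k[X]} (hab : IsCoprime a b)
    (h : a * (X ^ Fintype.card k - X) ^ 2 = b * W.frobeniusSubNum) :
    IsPrimitiveRep ![a, b] (Point.map (W' := W) (FiniteField.frobeniusAlgHom k K)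
      (some _ y (nonsingular_generic hy)) - some _ y (nonsingular_generic hy)) := by
  refine ⟨span_range_pair.mpr (by simpa using hab), ?_⟩
  set q := Fintype.card k with hq
  have hinj := FaithfulSMul.algebraMap_injective k[X] K
  have hne : algebraMap k[X] K X ^ q ≠ algebraMap k[X] K X := by
    rw [← map_pow]
    exact fun h ↦ FiniteField.X_pow_card_sub_X_ne_zero k (Fintype.one_lt_card (α := k))
      (sub_eq_zero.mpr (hinj h))
  have hnum := map_frobeniusResultant_eq (algebraMap k[X] K) (t := W.yTrace) (n := W.yNorm)
    (α := y) (β := algebraMap k[X] K W.yTrace - y) (by ring) (by linear_combination hy) q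
  have htq : algebraMap k[X] K W.yTrace ^ q =
      -((W⁄K).a₁ * algebraMap k[X] K X ^ q + (W⁄K).a₃) := by
    have h := congrArg (FiniteField.frobeniusAlgHom k K) (algebraMap_yTrace (W := W) (K := K))
    have ha (c : k) : algebraMap k K c ^ q = algebraMap k K c := by
      rw [← map_pow, FiniteField.pow_card]
    simp only [map_neg, map_add, map_mul, FiniteField.coe_frobeniusAlgHom] at h
    rw [h]
    congr 2
    · exact congrArg (· * _) (ha _)
    · exact ha _
  have hyq : (algebraMap k[X] K W.yTrace - y) ^ q = algebraMap k[X] K W.yTrace ^ q - y ^ q :=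
    map_sub (FiniteField.frobeniusAlgHom k K) _ _
  have hx0 : algebraMap k[X] K X ^ q - algebraMap k[X] K X ≠ 0 := sub_ne_zero.mpr hne
  rw [sub_eq_add_neg, map_some, neg_some]
  simp only [FiniteField.coe_frobeniusAlgHom]
  rw [add_of_X_ne hne, xRep_some, slope_of_X_ne hne]
  change algebraMap k[X] K a * 1 = algebraMap k[X] K b * addX ..
  have h := congrArg (algebraMap k[X] K) h
  have ha₂ : algebraMap k[X] K (C W.a₂) = (W⁄K).a₂ := by
    rw [← algebraMap_eq, ← IsScalarTower.algebraMap_apply]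
    rfl
  rw [frobeniusSubNum, ← hq, map_mul, map_mul, map_sub, hnum, hyq, htq, map_pow, map_sub, map_mul,
    map_add, map_add, map_pow, map_pow, map_sub, map_pow, ha₂, algebraMap_yTrace] at h
  refine mul_right_cancel₀ (pow_ne_zero 2 hx0) ?_
  rw [mul_one, h, addX, negY, ← hq]
  field_simp
  ring

end WeierstrassCurve

end Generic

/-- **Hasse's theorem** (Theorem 22): if `A` is an elliptic curve over a finite field `k`
of `q` elements and `a` is the integer defined by `|A(k)| = 1 - a + q`, then `|a| ≤ 2√q`,
i.e. `a² ≤ 4q`. -/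
theorem hasse_bound (k : Type*) [Field k] [Fintype k]
    (W : WeierstrassCurve k) [W.IsElliptic] (a : ℤ)
    (h : (Nat.card W.toAffine.Point : ℤ) = 1 - a + (Fintype.card k : ℤ)) :
    a ^ 2 ≤ 4 * (Fintype.card k : ℤ) := by
  classical
  obtain ⟨b, d, hcop, hbd, hcard⟩ := W.exists_isCoprime_frobeniusSub
  let K := W.toAffine.FunctionField
  have : FaithfulSMul k[X] K := .trans k[X] W.toAffine.CoordinateRing K
  have hroot : algebraMap W.toAffine.CoordinateRing K (AdjoinRoot.root W.toAffine.polynomial) ^ 2 =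
      algebraMap k[X] K W.yTrace * algebraMap _ K (AdjoinRoot.root W.toAffine.polynomial) -
        algebraMap k[X] K W.yNorm := by
    rw [← map_pow, W.root_sq, map_sub, map_mul, ← IsScalarTower.algebraMap_apply,
      ← IsScalarTower.algebraMap_apply]
  have hodd := WeierstrassCurve.generic_mem_oddSubgroup (σ := W.functionFieldConj.restrictScalars k)
    (W.functionFieldConj.commutes X)
    ((W.functionFieldConj_algebraMap _).trans <| by
      rw [W.conj_root, map_sub, ← IsScalarTower.algebraMap_apply])
    (WeierstrassCurve.nonsingular_generic hroot)
  have hdeg (m : ℕ) : tupleDegree ![(X : k[X]) ^ m, 1] = m := by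
    simp [tupleDegree_pair]
  rw [← hdeg (Fintype.card k)]
  refine WeierstrassCurve.Affine.Point.sq_le_four_mul_of_isPrimitiveRep
    (fun z hz ↦ W.exists_of_functionFieldConj_eq hz) hodd
    (WeierstrassCurve.map_frobenius_mem_oddSubgroup hodd) (v := ![X ^ 1, 1]) ⟨?_, ?_⟩ ⟨?_, ?_⟩
    (WeierstrassCurve.isPrimitiveRep_frobenius_sub hroot hcop hbd) (hdeg 1) ?_
  · exact WeierstrassCurve.Affine.Point.span_range_pair.mpr (by simpa using isCoprime_one_right)
  · simp
  · exact WeierstrassCurve.Affine.Point.span_range_pair.mpr (by simpa using isCoprime_one_right)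
  · simp [WeierstrassCurve.Affine.Point.map_some]
  · rw [hdeg]
    rw [tupleDegree_pair, hcard, h]
    ring
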